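/- Unconditional entropy power inequality for Gaussian states: Let n ≥ 1, let λ ∈ [0,1], and let M₁, M₂ be valid quantum covariance matrices of size 2n. Then λ·M₁ + (1−λ)·M₂ is again a valid quantum covariance matrix, and E(λ·M₁ + (1−λ)·M₂) ≥ λ·E(M₁) + (1−λ)·E(M₂). -/

import Mathlib

open scoped Classical ComplexOrder

noncomputable section

/-- The function `g(x) = (x+1)·log(x+1) − x·log x` (with `g 0 = 0` since `log 0 = 0`). -/
def gFn (x : ℝ) : ℝ := (x + 1) * Real.log (x + 1) - x * Real.log x

/-- Single-mode entropy as a function of the symplectic eigenvalue: `G(λ) = g((λ−1)/2)`. -/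
def GFn (lam : ℝ) : ℝ := gFn ((lam - 1) / 2)

/-- Inverse temperature `β(λ) = log((λ+1)/(λ−1))`. -/
def betaFn (lam : ℝ) : ℝ := Real.log ((lam + 1) / (lam - 1))

/-- The standard symplectic form matrix on `ℝ^d` (for even `d = 2N` this is the
block-diagonal matrix with `N` diagonal blocks `[[0,1],[-1,0]]`). -/
def Jmat (d : ℕ) : Matrix (Fin d) (Fin d) ℝ := fun i j =>
  if (i : ℕ) % 2 = 0 ∧ (j : ℕ) = (i : ℕ) + 1 then 1
  else if (j : ℕ) % 2 = 0 ∧ (i : ℕ) = (j : ℕ) + 1 then -1 else 0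

/-- A real `d×d` matrix is symplectic if `S·J·Sᵀ = J`. -/
def IsSymplectic {d : ℕ} (S : Matrix (Fin d) (Fin d) ℝ) : Prop :=
  S * Jmat d * S.transpose = Jmat d

/-- The doubled diagonal matrix `D(λ) = diag(λ₀,λ₀,λ₁,λ₁,…)`. -/
def Dmat (d : ℕ) (lam : ℕ → ℝ) : Matrix (Fin d) (Fin d) ℝ :=
  Matrix.diagonal fun i => lam ((i : ℕ) / 2)

/-- A valid quantum covariance matrix: `M` symmetric with `M + i·J ⪰ 0`. -/
def IsQCov {d : ℕ} (M : Matrix (Fin d) (Fin d) ℝ) : Prop :=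
  M.IsSymm ∧
    (M.map (Complex.ofReal) + Complex.I • (Jmat d).map Complex.ofReal).PosSemidef

/-- Entropy functional `E(M) = Σⱼ G(λⱼ)` where `λⱼ` are the symplectic eigenvalues of `M`:
the eigenvalues of `i·J·M` are `±λⱼ`, so `E(M) = (1/2)·Σ_{μ root of charpoly} G(|Re μ|)`. -/
def Ent {d : ℕ} (M : Matrix (Fin d) (Fin d) ℝ) : ℝ :=
  ((Matrix.charpoly (Complex.I • ((Jmat d * M).map Complex.ofReal))).roots.map
    fun μ => GFn |μ.re|).sum / 2

/-- The matrix `I_A ⊕ 0_B`: identity on the first `a` coordinates, zero on the rest. -/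
def IA0B (d a : ℕ) : Matrix (Fin d) (Fin d) ℝ :=
  Matrix.diagonal fun i => if (i : ℕ) < a then 1 else 0

/-- Assemble a symmetric 2×2 block matrix `[[A, K], [Kᵀ, B]]`. -/
def assemble2 {a b : ℕ} (A : Matrix (Fin a) (Fin a) ℝ) (K : Matrix (Fin a) (Fin b) ℝ)
    (B : Matrix (Fin b) (Fin b) ℝ) : Matrix (Fin (a + b)) (Fin (a + b)) ℝ := fun i j =>
  if hi : (i : ℕ) < a then
    if hj : (j : ℕ) < a then A ⟨i, hi⟩ ⟨j, hj⟩
    else K ⟨i, hi⟩ ⟨(j : ℕ) - a, by have := j.isLt; omega⟩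
  else
    if hj : (j : ℕ) < a then K ⟨j, hj⟩ ⟨(i : ℕ) - a, by have := i.isLt; omega⟩
    else B ⟨(i : ℕ) - a, by have := i.isLt; omega⟩ ⟨(j : ℕ) - a, by have := j.isLt; omega⟩

/-- Assemble the symmetric 3×3 block matrix
`[[Y, K₁, K₂], [K₁ᵀ, B₁, 0], [K₂ᵀ, 0, B₂]]`. -/
def assemble3 {a b c : ℕ} (Y : Matrix (Fin a) (Fin a) ℝ)
    (K₁ : Matrix (Fin a) (Fin b) ℝ) (K₂ : Matrix (Fin a) (Fin c) ℝ)
    (B₁ : Matrix (Fin b) (Fin b) ℝ) (B₂ : Matrix (Fin c) (Fin c) ℝ) :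
    Matrix (Fin (a + b + c)) (Fin (a + b + c)) ℝ := fun i j =>
  if hi : (i : ℕ) < a then
    if hj : (j : ℕ) < a then Y ⟨i, hi⟩ ⟨j, hj⟩
    else if hj' : (j : ℕ) < a + b then K₁ ⟨i, hi⟩ ⟨(j : ℕ) - a, by omega⟩
    else K₂ ⟨i, hi⟩ ⟨(j : ℕ) - a - b, by have := j.isLt; omega⟩
  else if hi' : (i : ℕ) < a + b then
    if hj : (j : ℕ) < a then K₁ ⟨j, hj⟩ ⟨(i : ℕ) - a, by omega⟩
    else if hj' : (j : ℕ) < a + b then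
      B₁ ⟨(i : ℕ) - a, by omega⟩ ⟨(j : ℕ) - a, by omega⟩
    else 0
  else
    if hj : (j : ℕ) < a then K₂ ⟨j, hj⟩ ⟨(i : ℕ) - a - b, by have := i.isLt; omega⟩
    else if hj' : (j : ℕ) < a + b then 0
    else B₂ ⟨(i : ℕ) - a - b, by have := i.isLt; omega⟩
      ⟨(j : ℕ) - a - b, by have := j.isLt; omega⟩

open Matrix in
/-- The logarithm of the determinant of a positive definite matrix lies below its tangent at `1`. -/
theorem log_norm_det_le_trace_sub_card {ι : Type*} [Fintype ι] [DecidableEq ι]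
    {X : Matrix ι ι ℂ} (hX : X.PosDef) :
    Real.log ‖X.det‖ ≤ X.trace.re - Fintype.card ι := by
  have hpos := hX.eigenvalues_pos
  have htr : X.trace.re = ∑ i, hX.1.eigenvalues i := by
    rw [hX.1.trace_eq_sum_eigenvalues]
    simp
  rw [hX.1.det_eq_prod_eigenvalues, norm_prod, Real.log_prod, htr]
  · calc ∑ i, Real.log ‖((hX.1.eigenvalues i : ℝ) : ℂ)‖
        ≤ ∑ i, (hX.1.eigenvalues i - 1) := by
          refine Finset.sum_le_sum fun i _ => ?_
          rw [Complex.norm_real, Real.norm_of_nonneg (hpos i).le]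
          exact Real.log_le_sub_one_of_pos (hpos i)
      _ = _ := by simp
  · intro i _
    simpa using (hpos i).ne'

open Matrix MatrixOrder Matrix.Norms.L2Operator in
/-- Tangent inequality for `log det` at a positive definite matrix `C`. -/
theorem log_norm_det_le_tangent {ι : Type*} [Fintype ι] [DecidableEq ι]
    {A C : Matrix ι ι ℂ} (hA : A.PosDef) (hC : C.PosDef) :
    Real.log ‖A.det‖ ≤ Real.log ‖C.det‖ + ((C⁻¹ * A).trace.re - Fintype.card ι) := by
  obtain ⟨W, hW⟩ := CStarAlgebra.nonneg_iff_eq_star_mul_self.mp hC.inv.posSemidef.nonneg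
  rw [star_eq_conjTranspose] at hW
  have hCdet : C.det ≠ 0 := hC.det_pos.ne'
  have hAdet : A.det ≠ 0 := hA.det_pos.ne'
  have hdet : C.det * (Wᴴ.det * W.det) = 1 := by
    rw [← det_mul, ← hW, ← det_mul, mul_nonsing_inv _ hCdet.isUnit, det_one]
  have hWdet : W.det ≠ 0 := by
    rintro h
    simp [h] at hdet
  have hWunit : IsUnit W := (isUnit_iff_isUnit_det W).mpr hWdet.isUnit
  have hX : (W * A * Wᴴ).PosDef := by
    have := (IsUnit.posDef_star_right_conjugate_iff (x := A) hWunit).mpr hA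
    rwa [star_eq_conjTranspose] at this
  have key := log_norm_det_le_trace_sub_card hX
  have htr : (W * A * Wᴴ).trace = (C⁻¹ * A).trace := by
    rw [hW, trace_mul_comm, ← mul_assoc]
  have hd : ‖(W * A * Wᴴ).det‖ * ‖C.det‖ = ‖A.det‖ := by
    rw [← norm_mul, det_mul, det_mul]
    congr 1
    linear_combination A.det * hdet
  have hXdet : (W * A * Wᴴ).det ≠ 0 := hX.det_pos.ne'
  rw [← hd, Real.log_mul (norm_ne_zero_iff.mpr hXdet) (norm_ne_zero_iff.mpr hCdet), ← htr]
  linarith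

/-- Concavity of `log det` on positive definite matrices. -/
theorem log_norm_det_concave {ι : Type*} [Fintype ι] [DecidableEq ι]
    {A B : Matrix ι ι ℂ} (hA : A.PosDef) (hB : B.PosDef) {t : ℝ} (h0 : 0 ≤ t) (h1 : t ≤ 1)
    (hC : ((t : ℂ) • A + ((1 - t : ℝ) : ℂ) • B).PosDef) :
    t * Real.log ‖A.det‖ + (1 - t) * Real.log ‖B.det‖ ≤
      Real.log ‖((t : ℂ) • A + ((1 - t : ℝ) : ℂ) • B).det‖ := by
  set C := (t : ℂ) • A + ((1 - t : ℝ) : ℂ) • B with hCdef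
  have hCdet : C.det ≠ 0 := hC.det_pos.ne'
  have htr : t * (C⁻¹ * A).trace.re + (1 - t) * (C⁻¹ * B).trace.re = Fintype.card ι := by
    have h : (C⁻¹ * C).trace = (Fintype.card ι : ℂ) := by
      rw [Matrix.nonsing_inv_mul _ hCdet.isUnit, Matrix.trace_one]
    have h2 : (C⁻¹ * C).trace =
        (t : ℂ) * (C⁻¹ * A).trace + ((1 - t : ℝ) : ℂ) * (C⁻¹ * B).trace := by
      conv_lhs => rw [hCdef, mul_add, Matrix.mul_smul, Matrix.mul_smul, Matrix.trace_add,
        Matrix.trace_smul, Matrix.trace_smul, smul_eq_mul, smul_eq_mul]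
    have h3 := congrArg Complex.re (h2.symm.trans h)
    simpa only [Complex.add_re, Complex.re_ofReal_mul, Complex.natCast_re] using h3
  have hA' := mul_le_mul_of_nonneg_left (log_norm_det_le_tangent hA hC) h0
  have hB' := mul_le_mul_of_nonneg_left (log_norm_det_le_tangent hB hC) (sub_nonneg.mpr h1)
  linarith

theorem Jmat_transpose (d : ℕ) : (Jmat d).transpose = -Jmat d := by
  ext i j
  simp only [Matrix.transpose_apply, Matrix.neg_apply, Jmat]
  split_ifs <;> first | omega | norm_num

theorem Jmat_mul_self (n : ℕ) : Jmat (2 * n) * Jmat (2 * n) = -1 := by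
  ext i k
  rw [Matrix.mul_apply, Matrix.neg_apply, Matrix.one_apply]
  have hp : (if (i : ℕ) % 2 = 0 then (i : ℕ) + 1 else (i : ℕ) - 1) < 2 * n := by
    have := i.isLt
    split_ifs <;> omega
  rw [Finset.sum_eq_single ⟨_, hp⟩]
  · simp only [Jmat, Fin.ext_iff]
    split_ifs <;> first | omega | norm_num
  · intro j _ hj
    have hj' : (j : ℕ) ≠ if (i : ℕ) % 2 = 0 then (i : ℕ) + 1 else (i : ℕ) - 1 :=
      fun h => hj (Fin.ext h)
    simp only [Jmat]
    split_ifs at hj' ⊢ <;> first | omega | norm_num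
  · simp

/-- The Hermitian involution `i·J`. -/
def hermJ (d : ℕ) : Matrix (Fin d) (Fin d) ℂ := Complex.I • (Jmat d).map Complex.ofReal

theorem hermJ_mul_self (n : ℕ) : hermJ (2 * n) * hermJ (2 * n) = 1 := by
  have h : (Jmat (2 * n)).map Complex.ofReal * (Jmat (2 * n)).map Complex.ofReal =
      (-1 : Matrix (Fin (2 * n)) (Fin (2 * n)) ℂ) := by
    have h' := congrArg Complex.ofRealHom.mapMatrix (Jmat_mul_self n)
    rwa [map_mul, map_neg, map_one] at h'
  rw [hermJ, Matrix.smul_mul, Matrix.mul_smul, h, smul_smul, Complex.I_mul_I, neg_smul, one_smul,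
    neg_neg]

/-- The Hermitian matrix `M + i·s·J`. -/
def hermShift {d : ℕ} (M : Matrix (Fin d) (Fin d) ℝ) (s : ℝ) : Matrix (Fin d) (Fin d) ℂ :=
  M.map Complex.ofReal + (s : ℂ) • hermJ d

theorem isQCov_iff {d : ℕ} {M : Matrix (Fin d) (Fin d) ℝ} :
    IsQCov M ↔ M.IsSymm ∧ (hermShift M 1).PosSemidef := by
  simp [IsQCov, hermShift, hermJ]

theorem hermShift_transpose {d : ℕ} {M : Matrix (Fin d) (Fin d) ℝ} (hM : M.IsSymm) (s : ℝ) :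
    (hermShift M s).transpose = hermShift M (-s) := by
  ext i j
  have h := congrFun (congrFun (Jmat_transpose d) i) j
  have h' := congrFun (congrFun hM i) j
  simp only [Matrix.transpose_apply, Matrix.neg_apply] at h h'
  simp [hermShift, hermJ, h, h']

theorem hermShift_eq_combination {d : ℕ} (M : Matrix (Fin d) (Fin d) ℝ) (s : ℝ) :
    hermShift M s =
      (((1 + s) / 2 : ℝ) : ℂ) • hermShift M 1 + (((1 - s) / 2 : ℝ) : ℂ) • hermShift M (-1) := by
  ext i j
  simp [hermShift]
  ring

theorem hermShift_convex {d : ℕ} (M₁ M₂ : Matrix (Fin d) (Fin d) ℝ) (t s : ℝ) :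
    hermShift (t • M₁ + (1 - t) • M₂) s =
      (t : ℂ) • hermShift M₁ s + ((1 - t : ℝ) : ℂ) • hermShift M₂ s := by
  ext i j
  simp [hermShift]
  ring

theorem IsQCov.convex {d : ℕ} {M₁ M₂ : Matrix (Fin d) (Fin d) ℝ} (h₁ : IsQCov M₁)
    (h₂ : IsQCov M₂) {t : ℝ} (h0 : 0 ≤ t) (h1 : t ≤ 1) : IsQCov (t • M₁ + (1 - t) • M₂) := by
  rw [isQCov_iff] at *
  refine ⟨(h₁.1.smul t).add (h₂.1.smul (1 - t)), ?_⟩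
  rw [hermShift_convex]
  exact (h₁.2.smul (by exact_mod_cast h0)).add
    (h₂.2.smul (by exact_mod_cast sub_nonneg.mpr h1))

theorem IsQCov.posSemidef_one {d : ℕ} {M : Matrix (Fin d) (Fin d) ℝ} (h : IsQCov M) :
    (hermShift M 1).PosSemidef := (isQCov_iff.mp h).2

theorem IsQCov.posSemidef_neg_one {d : ℕ} {M : Matrix (Fin d) (Fin d) ℝ} (h : IsQCov M) :
    (hermShift M (-1)).PosSemidef := by
  rw [← hermShift_transpose h.1]
  exact h.posSemidef_one.transpose

open Matrix in
/-- `M + i·J` and `M - i·J` have no common isotropic vector. -/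
theorem IsQCov.eq_zero_of_isotropic {n : ℕ} {M : Matrix (Fin (2 * n)) (Fin (2 * n)) ℝ}
    (h : IsQCov M) {v : Fin (2 * n) → ℂ}
    (hp : star v ⬝ᵥ hermShift M 1 *ᵥ v = 0) (hq : star v ⬝ᵥ hermShift M (-1) *ᵥ v = 0) :
    v = 0 := by
  rw [h.posSemidef_one.dotProduct_mulVec_zero_iff] at hp
  rw [h.posSemidef_neg_one.dotProduct_mulVec_zero_iff] at hq
  have hdiff : (2 : ℂ) • hermJ (2 * n) = hermShift M 1 - hermShift M (-1) := by
    rw [hermShift, hermShift, two_smul]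
    simp
  have hJv : hermJ (2 * n) *ᵥ v = 0 := by
    have h2 : (2 : ℂ) • hermJ (2 * n) *ᵥ v = 0 := by
      rw [← smul_mulVec, hdiff, sub_mulVec, hp, hq, sub_zero]
    exact (smul_eq_zero.mp h2).resolve_left two_ne_zero
  rw [← one_mulVec v, ← hermJ_mul_self, ← mulVec_mulVec, hJv, mulVec_zero]

open Matrix in
theorem IsQCov.posDef_hermShift {n : ℕ} {M : Matrix (Fin (2 * n)) (Fin (2 * n)) ℝ}
    (h : IsQCov M) {s : ℝ} (hs : s ∈ Set.Ioo (-1 : ℝ) 1) : (hermShift M s).PosDef := by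
  have ha : (0 : ℂ) < (((1 + s) / 2 : ℝ) : ℂ) := by
    exact_mod_cast (by linarith [hs.1] : (0 : ℝ) < (1 + s) / 2)
  have hb : (0 : ℂ) < (((1 - s) / 2 : ℝ) : ℂ) := by
    exact_mod_cast (by linarith [hs.2] : (0 : ℝ) < (1 - s) / 2)
  rw [hermShift_eq_combination]
  have hpsd := (h.posSemidef_one.smul ha.le).add (h.posSemidef_neg_one.smul hb.le)
  refine PosDef.of_dotProduct_mulVec_pos hpsd.1 fun {v} hv => ?_
  have hp := h.posSemidef_one.dotProduct_mulVec_nonneg v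
  have hq := h.posSemidef_neg_one.dotProduct_mulVec_nonneg v
  refine lt_of_le_of_ne (hpsd.dotProduct_mulVec_nonneg v) fun h0 => hv ?_
  rw [add_mulVec, smul_mulVec, smul_mulVec, dotProduct_add, dotProduct_smul, dotProduct_smul,
    smul_eq_mul, smul_eq_mul, eq_comm,
    add_eq_zero_iff_of_nonneg (mul_nonneg ha.le hp) (mul_nonneg hb.le hq)] at h0
  exact h.eq_zero_of_isotropic ((mul_eq_zero.mp h0.1).resolve_left ha.ne')
    ((mul_eq_zero.mp h0.2).resolve_left hb.ne')

/-- The matrix whose eigenvalues are plus and minus the symplectic eigenvalues of `M`. -/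
def hermJMul {d : ℕ} (M : Matrix (Fin d) (Fin d) ℝ) : Matrix (Fin d) (Fin d) ℂ :=
  Complex.I • (Jmat d * M).map Complex.ofReal

theorem hermJMul_eq {d : ℕ} (M : Matrix (Fin d) (Fin d) ℝ) :
    hermJMul M = hermJ d * M.map Complex.ofReal := by
  have h : (Jmat d * M).map Complex.ofReal =
      (Jmat d).map Complex.ofReal * M.map Complex.ofReal :=
    map_mul Complex.ofRealHom.mapMatrix (Jmat d) M
  rw [hermJMul, hermJ, Matrix.smul_mul, h]

theorem hermJ_mul_hermShift {n : ℕ} (M : Matrix (Fin (2 * n)) (Fin (2 * n)) ℝ) (s : ℝ) :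
    hermJ (2 * n) * hermShift M s = hermJMul M + (s : ℂ) • 1 := by
  rw [hermShift, mul_add, Matrix.mul_smul, hermJ_mul_self, hermJMul_eq]

theorem norm_det_hermJ (n : ℕ) : ‖(hermJ (2 * n)).det‖ = 1 := by
  have h := congrArg (fun X => ‖Matrix.det X‖) (hermJ_mul_self n)
  simp only [Matrix.det_mul, Matrix.det_one, norm_mul, norm_one] at h
  nlinarith [norm_nonneg (hermJ (2 * n)).det]

open Matrix in
/-- The eigenvalues of `i·J·M` are real and of modulus at least one. -/
theorem IsQCov.eigenvalue_real {n : ℕ} {M : Matrix (Fin (2 * n)) (Fin (2 * n)) ℝ}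
    (h : IsQCov M) {μ : ℂ} (hμ : μ ∈ (hermJMul M).charpoly.roots) :
    μ.im = 0 ∧ 1 ≤ |μ.re| := by
  have hroot : (hermJMul M).charpoly.eval μ = 0 := (Polynomial.mem_roots'.mp hμ).2
  rw [eval_charpoly, ← exists_mulVec_eq_zero_iff] at hroot
  obtain ⟨v, hv0, hv⟩ := hroot
  have hAv : hermJMul M *ᵥ v = μ • v := by
    rw [sub_mulVec, sub_eq_zero] at hv
    rw [← hv]
    simp
  have hMv : M.map Complex.ofReal *ᵥ v = μ • hermJ (2 * n) *ᵥ v := by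
    rw [← mulVec_smul, ← hAv, mulVec_mulVec, hermJMul_eq, ← mul_assoc, hermJ_mul_self, one_mul]
  set b := star v ⬝ᵥ hermJ (2 * n) *ᵥ v with hb
  have hform (s : ℝ) : star v ⬝ᵥ hermShift M s *ᵥ v = (μ + s) * b := by
    rw [hermShift, add_mulVec, smul_mulVec, hMv, ← add_smul, dotProduct_smul, smul_eq_mul]
  have hp := h.posSemidef_one.dotProduct_mulVec_nonneg v
  have hq := h.posSemidef_neg_one.dotProduct_mulVec_nonneg v
  have hb0 : b ≠ 0 := by
    intro hb0
    exact hv0 (h.eq_zero_of_isotropic (by rw [hform, hb0, mul_zero]) (by rw [hform, hb0, mul_zero]))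
  rw [hform, Complex.nonneg_iff] at hp hq
  simp only [Complex.mul_re, Complex.mul_im, Complex.add_re, Complex.add_im, Complex.ofReal_re,
    Complex.ofReal_im] at hp hq
  have hbim : b.im = 0 := by linarith [hp.2, hq.2]
  have hbre : b.re ≠ 0 := fun hr => hb0 (Complex.ext hr hbim)
  have him : μ.im = 0 := by
    have h2 := hp.2
    rw [hbim] at h2
    have h3 : μ.im * b.re = 0 := by linarith
    exact (mul_eq_zero.mp h3).resolve_right hbre
  refine ⟨him, ?_⟩
  rw [hbim, him] at hp hq
  have h1 : 0 ≤ ((μ.re + 1) * b.re) * ((μ.re + -1) * b.re) :=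
    mul_nonneg (by linarith [hp.1]) (by linarith [hq.1])
  have h2 : 0 < b.re ^ 2 := by positivity
  have h3 : 0 ≤ μ.re ^ 2 - 1 := by
    refine nonneg_of_mul_nonneg_left ?_ h2
    linarith
  rw [← one_le_sq_iff_one_le_abs]
  linarith

theorem log_norm_prod_eq_sum (m : Multiset ℂ) (s : ℝ)
    (hm : ∀ μ ∈ m, μ.im = 0 ∧ μ.re + s ≠ 0) :
    Real.log ‖(m.map fun μ => -(s : ℂ) - μ).prod‖ =
      (m.map fun μ => Real.log (μ.re + s)).sum := by
  induction m using Multiset.induction with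
  | empty => simp
  | cons a m ih =>
    obtain ⟨him, hre⟩ := hm a (Multiset.mem_cons_self a m)
    have hm' : ∀ μ ∈ m, μ.im = 0 ∧ μ.re + s ≠ 0 := fun μ h => hm μ (Multiset.mem_cons_of_mem h)
    have ha : -(s : ℂ) - a = ((-(a.re + s) : ℝ) : ℂ) := by
      apply Complex.ext <;> simp [him]
      ring
    have hprod : (m.map fun μ => -(s : ℂ) - μ).prod ≠ 0 := by
      refine Multiset.prod_ne_zero fun h0 => ?_
      obtain ⟨μ, hμ, h⟩ := Multiset.mem_map.mp h0
      refine (hm' μ hμ).2 ?_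
      have hre' := congrArg Complex.re h
      simp only [Complex.sub_re, Complex.neg_re, Complex.ofReal_re, Complex.zero_re] at hre'
      linarith
    rw [Multiset.map_cons, Multiset.map_cons, Multiset.prod_cons, Multiset.sum_cons, norm_mul, ha,
      Complex.norm_real, Real.log_mul (norm_ne_zero_iff.mpr (neg_ne_zero.mpr hre)) (norm_ne_zero_iff.mpr hprod), ih hm',
      Real.norm_eq_abs, Real.log_abs, Real.log_neg_eq_log]

theorem IsQCov.re_add_ne_zero {n : ℕ} {M : Matrix (Fin (2 * n)) (Fin (2 * n)) ℝ}
    (h : IsQCov M) {s : ℝ} (hs : s ∈ Set.Ioo (-1 : ℝ) 1) {μ : ℂ}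
    (hμ : μ ∈ (hermJMul M).charpoly.roots) : μ.re + s ≠ 0 := by
  have h1 := (h.eigenvalue_real hμ).2
  intro h0
  rw [eq_neg_of_add_eq_zero_left h0, abs_neg] at h1
  exact absurd (abs_lt.mpr hs) (not_lt.mpr h1)

/-- `log |det (M + i·s·J)|` as a sum over the spectrum of `i·J·M`. -/
theorem IsQCov.log_norm_det_hermShift {n : ℕ} {M : Matrix (Fin (2 * n)) (Fin (2 * n)) ℝ}
    (h : IsQCov M) {s : ℝ} (hs : s ∈ Set.Ioo (-1 : ℝ) 1) :
    Real.log ‖(hermShift M s).det‖ =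
      ((hermJMul M).charpoly.roots.map fun μ => Real.log (μ.re + s)).sum := by
  rw [← log_norm_prod_eq_sum _ s fun μ hμ => ⟨(h.eigenvalue_real hμ).1, h.re_add_ne_zero hs hμ⟩,
    ← (IsAlgClosed.splits _).eval_eq_prod_roots_of_monic (Matrix.charpoly_monic _),
    Matrix.eval_charpoly]
  have h1 : Matrix.scalar (Fin (2 * n)) (-(s : ℂ)) - hermJMul M =
      -(hermJ (2 * n) * hermShift M s) := by
    rw [hermJ_mul_hermShift, Matrix.scalar_apply, ← Matrix.smul_one_eq_diagonal, neg_smul]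
    abel
  rw [h1, Matrix.det_neg, Matrix.det_mul, norm_mul, norm_mul, norm_det_hermJ]
  simp

/-- The entropy function as an average of logarithms. -/
theorem integral_log_add {x : ℝ} (hx : 1 ≤ |x|) :
    ∫ s in (-1 : ℝ)..1, Real.log (x + s) = 2 * GFn |x| - 2 * (1 - Real.log 2) := by
  have main {y : ℝ} (hy : 1 ≤ y) :
      ∫ s in (y - 1)..(y + 1), Real.log s = 2 * GFn y - 2 * (1 - Real.log 2) := by
    have h1 : (y - 1) / 2 + 1 = (y + 1) / 2 := by ring
    rw [integral_log, GFn, gFn, h1, Real.log_div (by linarith) two_ne_zero]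
    rcases hy.eq_or_lt with rfl | hy
    · norm_num
      ring
    · rw [Real.log_div (by linarith) two_ne_zero]
      ring
  rw [intervalIntegral.integral_comp_add_left (fun s => Real.log s)]
  rcases le_total 0 x with h0 | h0
  · rw [abs_of_nonneg h0] at hx ⊢
    rw [← main hx, sub_eq_add_neg]
  · rw [abs_of_nonpos h0] at hx ⊢
    have h2 := intervalIntegral.integral_comp_neg (a := x + -1) (b := x + 1) Real.log
    simp only [Real.log_neg_eq_log] at h2
    rw [h2, ← main hx]
    congr 1 <;> ring

theorem intervalIntegrable_log_add (x : ℝ) :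
    IntervalIntegrable (fun s => Real.log (x + s)) MeasureTheory.volume (-1) 1 := by
  have h := (intervalIntegral.intervalIntegrable_log' (a := x + -1) (b := x + 1)).comp_add_left x
  simpa using h

theorem intervalIntegrable_sum_log (m : Multiset ℂ) :
    IntervalIntegrable (fun s : ℝ => (m.map fun μ => Real.log (μ.re + s)).sum)
      MeasureTheory.volume (-1) 1 := by
  induction m using Multiset.induction with
  | empty => simp
  | cons a m ih =>
    simp only [Multiset.map_cons, Multiset.sum_cons]
    exact (intervalIntegrable_log_add a.re).add ih

theorem integral_sum_log (m : Multiset ℂ) (hm : ∀ μ ∈ m, 1 ≤ |μ.re|) :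
    ∫ s in (-1 : ℝ)..1, (m.map fun μ => Real.log (μ.re + s)).sum =
      2 * (m.map fun μ => GFn |μ.re|).sum - m.card * (2 * (1 - Real.log 2)) := by
  induction m using Multiset.induction with
  | empty => simp
  | cons a m ih =>
    simp only [Multiset.map_cons, Multiset.sum_cons, Multiset.card_cons]
    rw [intervalIntegral.integral_add (intervalIntegrable_log_add a.re)
      (intervalIntegrable_sum_log m), integral_log_add (hm a (Multiset.mem_cons_self a m)),
      ih fun μ h => hm μ (Multiset.mem_cons_of_mem h)]
    push_cast
    ring

/-- The entropy is, up to a constant, the average of `log |det (M + i·s·J)|`. -/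
theorem IsQCov.integral_eq_ent {n : ℕ} {M : Matrix (Fin (2 * n)) (Fin (2 * n)) ℝ}
    (h : IsQCov M) :
    ∫ s in (-1 : ℝ)..1, ((hermJMul M).charpoly.roots.map fun μ => Real.log (μ.re + s)).sum =
      4 * Ent M - 2 * n * (2 * (1 - Real.log 2)) := by
  have hcard : (hermJMul M).charpoly.roots.card = 2 * n := by
    rw [← (IsAlgClosed.splits _).natDegree_eq_card_roots, Matrix.charpoly_natDegree_eq_dim,
      Fintype.card_fin]
  rw [integral_sum_log _ fun μ hμ => (h.eigenvalue_real hμ).2, hcard]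
  simp only [Ent, hermJMul]
  push_cast
  ring

/-- Unconditional entropy power inequality for Gaussian states. -/
theorem epi_gaussian_unconditional (n : ℕ) (hn : 1 ≤ n) (lam : ℝ)
    (h0 : 0 ≤ lam) (h1 : lam ≤ 1)
    (M₁ M₂ : Matrix (Fin (2 * n)) (Fin (2 * n)) ℝ)
    (hM₁ : IsQCov M₁) (hM₂ : IsQCov M₂) :
    IsQCov (lam • M₁ + (1 - lam) • M₂) ∧
    Ent (lam • M₁ + (1 - lam) • M₂) ≥ lam * Ent M₁ + (1 - lam) * Ent M₂ := by
  have hM := hM₁.convex hM₂ h0 h1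
  refine ⟨hM, ?_⟩
  have key := intervalIntegral.integral_mono_on_of_le_Ioo (μ := MeasureTheory.volume)
    (by norm_num : (-1 : ℝ) ≤ 1)
    (((intervalIntegrable_sum_log (hermJMul M₁).charpoly.roots).const_mul lam).add
      ((intervalIntegrable_sum_log (hermJMul M₂).charpoly.roots).const_mul (1 - lam)))
    (intervalIntegrable_sum_log (hermJMul (lam • M₁ + (1 - lam) • M₂)).charpoly.roots)
    fun s hs => by
      rw [← hM.log_norm_det_hermShift hs, ← hM₁.log_norm_det_hermShift hs,
        ← hM₂.log_norm_det_hermShift hs]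
      have hC := hM.posDef_hermShift hs
      rw [hermShift_convex] at hC ⊢
      exact log_norm_det_concave (hM₁.posDef_hermShift hs) (hM₂.posDef_hermShift hs) h0 h1 hC
  rw [intervalIntegral.integral_add
      ((intervalIntegrable_sum_log (hermJMul M₁).charpoly.roots).const_mul lam)
      ((intervalIntegrable_sum_log (hermJMul M₂).charpoly.roots).const_mul (1 - lam)),
    intervalIntegral.integral_const_mul, intervalIntegral.integral_const_mul,
    hM₁.integral_eq_ent, hM₂.integral_eq_ent, hM.integral_eq_ent] at key
  linarith

end
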